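/- arXiv:2204.12026 — 4 statements merged into one kernel-verified Lean document; each statement's English description precedes it below -/
import Mathlib

section
/- (Value function is 1-Lipschitz with respect to any on-policy bisimulation premetric; deterministic form of Theorem 3 of Castro 2019.) Let d : S × S → ℝ be any nonnegative function satisfying, for all states s, t, the subsolution inequality d(s, t) ≥ |r(s, π(s)) − r(t, π(t))| + γ · d(T(s, π(s)), T(t, π(t))). Then for all states s, t: |V^π(s) − V^π(t)| ≤ d(s, t). -/
/-- The trajectory of policy `π` in the deterministic MDP with transition `T`,
starting from `s`: `traj T π s 0 = s`, `traj T π s (k+1) = T (traj T π s k) (π (traj T π s k))`. -/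
noncomputable def traj {S A : Type*} (T : S → A → S) (π : S → A) (s : S) : ℕ → S :=
  fun k => (fun x => T x (π x))^[k] s

/-- The value function of policy `π` with discount `γ`. -/
noncomputable def V {S A : Type*} (T : S → A → S) (r : S → A → ℝ) (π : S → A)
    (γ : ℝ) (s : S) : ℝ :=
  ∑' k : ℕ, γ ^ k * r (traj T π s k) (π (traj T π s k))

/-- The value function is 1-Lipschitz with respect to any nonnegative function `d` satisfying the
on-policy bisimulation subsolution inequality
`d(s,t) ≥ |r(s,π(s)) − r(t,π(t))| + γ * d(T(s,π(s)), T(t,π(t)))`. -/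
theorem value_lipschitz_wrt_bisim_premetric {S A : Type*}
    (T : S → A → S) (r : S → A → ℝ) (π : S → A) (γ R : ℝ)
    (hγ0 : 0 ≤ γ) (hγ1 : γ < 1) (hR : ∀ s a, |r s a| ≤ R)
    (d : S → S → ℝ) (hd0 : ∀ s t, 0 ≤ d s t)
    (hd : ∀ s t, d s t ≥ |r s (π s) - r t (π t)| + γ * d (T s (π s)) (T t (π t))) :
    ∀ s t, |V T r π γ s - V T r π γ t| ≤ d s t := by
  have hsum : ∀ s, Summable (fun k : ℕ => γ ^ k * r (traj T π s k) (π (traj T π s k))) := by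
    intro s
    refine Summable.of_norm_bounded
      ((summable_geometric_of_lt_one hγ0 hγ1).mul_right R) (fun k => ?_)
    rw [Real.norm_eq_abs, abs_mul, abs_of_nonneg (pow_nonneg hγ0 k)]
    exact mul_le_mul_of_nonneg_left (hR _ _) (pow_nonneg hγ0 k)
  have hstep : ∀ s, ∀ n : ℕ,
      ∑ k ∈ Finset.range (n + 1), γ ^ k * r (traj T π s k) (π (traj T π s k)) =
      γ * (∑ k ∈ Finset.range n, γ ^ k * r (traj T π (T s (π s)) k)
        (π (traj T π (T s (π s)) k))) + r s (π s) := by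
    intro s n
    rw [Finset.sum_range_succ', Finset.mul_sum]
    congr 1
    · refine Finset.sum_congr rfl (fun k _ => ?_)
      simp only [traj, Function.iterate_succ_apply, pow_succ]
      ring
    · simp [traj]
  have hfin : ∀ n : ℕ, ∀ s t,
      |∑ k ∈ Finset.range n, γ ^ k * r (traj T π s k) (π (traj T π s k)) -
        ∑ k ∈ Finset.range n, γ ^ k * r (traj T π t k) (π (traj T π t k))| ≤ d s t := by
    intro n
    induction n with
    | zero => intro s t; simpa using hd0 s t
    | succ n ih =>
      intro s t
      rw [hstep, hstep]
      have h1 := mul_le_mul_of_nonneg_left (ih (T s (π s)) (T t (π t))) hγ0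
      have h2 := hd s t
      rw [← abs_of_nonneg hγ0, ← abs_mul, abs_of_nonneg hγ0, mul_sub] at h1
      refine le_trans ?_ h2
      rw [add_sub_add_comm, add_comm]
      refine (abs_add_le _ _).trans ?_
      linarith
  intro s t
  exact le_of_tendsto
    (((hsum s).hasSum.tendsto_sum_nat.sub (hsum t).hasSum.tendsto_sum_nat).abs)
    (Filter.Eventually.of_forall (fun n => hfin n s t))
end

section
/- (Pessimistic stitched value is a lower bound on the true value.) Assume that for every b ∈ B, |V^π_{(T,r)}(T(b, π(b))) − V^π_{(T,r)}(c(b))| ≤ ε(b). Then for every state s, V^π_{(T', r^−)}(s) ≤ V^π_{(T,r)}(s). -/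
open scoped Classical in
/-- The stitched transition function: `T'(s,a) = c(s)` if `s ∈ B` and `a = π(s)`, else `T(s,a)`. -/
noncomputable def Tstitch {S A : Type*} (T : S → A → S) (π : S → A) (B : Set S) (c : S → S) :
    S → A → S :=
  fun s a => if s ∈ B ∧ a = π s then c s else T s a

open scoped Classical in
/-- The pessimistic reward: `r⁻(s,a) = r(s,a) − γ·ε(s)` if `s ∈ B` and `a = π(s)`, else `r(s,a)`. -/
noncomputable def rPess {S A : Type*} (r : S → A → ℝ) (π : S → A) (B : Set S) (ε : S → ℝ)
    (γ : ℝ) : S → A → ℝ :=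
  fun s a => if s ∈ B ∧ a = π s then r s a - γ * ε s else r s a

open scoped Classical in
/-- The optimistic reward: `r⁺(s,a) = r(s,a) + γ·ε(s)` if `s ∈ B` and `a = π(s)`, else `r(s,a)`. -/
noncomputable def rOpt {S A : Type*} (r : S → A → ℝ) (π : S → A) (B : Set S) (ε : S → ℝ)
    (γ : ℝ) : S → A → ℝ :=
  fun s a => if s ∈ B ∧ a = π s then r s a + γ * ε s else r s a

theorem summable_aux {S A : Type*} (T : S → A → S) (r : S → A → ℝ) (π : S → A) (γ R : ℝ)
    (hγ0 : 0 ≤ γ) (hγ1 : γ < 1) (hR : ∀ s a, |r s a| ≤ R) (s : S) :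
    Summable (fun k : ℕ => γ ^ k * r (traj T π s k) (π (traj T π s k))) := by
  refine Summable.of_norm_bounded (g := fun k : ℕ => γ ^ k * R)
    ((summable_geometric_of_lt_one hγ0 hγ1).mul_right R) ?_
  intro k
  rw [Real.norm_eq_abs, abs_mul, abs_of_nonneg (pow_nonneg hγ0 k)]
  exact mul_le_mul_of_nonneg_left (hR _ _) (pow_nonneg hγ0 k)

theorem V_abs_le {S A : Type*} (T : S → A → S) (r : S → A → ℝ) (π : S → A) (γ R : ℝ)
    (hγ0 : 0 ≤ γ) (hγ1 : γ < 1) (hR : ∀ s a, |r s a| ≤ R) (s : S) :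
    |V T r π γ s| ≤ (1 - γ)⁻¹ * R := by
  have h := (hasSum_geometric_of_lt_one hγ0 hγ1).mul_right R
  rw [← Real.norm_eq_abs]
  unfold V
  refine tsum_of_norm_bounded h ?_
  intro k
  rw [Real.norm_eq_abs, abs_mul, abs_of_nonneg (pow_nonneg hγ0 k)]
  exact mul_le_mul_of_nonneg_left (hR _ _) (pow_nonneg hγ0 k)

theorem V_bellman {S A : Type*} (T : S → A → S) (r : S → A → ℝ) (π : S → A) (γ R : ℝ)
    (hγ0 : 0 ≤ γ) (hγ1 : γ < 1) (hR : ∀ s a, |r s a| ≤ R) (s : S) :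
    V T r π γ s = r s (π s) + γ * V T r π γ (T s (π s)) := by
  have h := (summable_aux T r π γ R hγ0 hγ1 hR s).tsum_eq_zero_add
  unfold V
  rw [h, ← tsum_mul_left]
  congr 1
  · simp [traj]
  · refine tsum_congr fun k => ?_
    simp only [traj, Function.iterate_succ_apply]
    ring

/-- Pessimistic stitched value is a lower bound on the true value: if every stitch `b ∈ B`
satisfies `|V^π_{(T,r)}(T(b,π(b))) − V^π_{(T,r)}(c(b))| ≤ ε(b)`, then
`V^π_{(T',r⁻)}(s) ≤ V^π_{(T,r)}(s)` for every state `s` (where the pessimistic stitched value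
function is well defined, i.e. its defining series is summable). -/
theorem pessimistic_stitched_value_le_true_value {S A : Type*}
    (T : S → A → S) (r : S → A → ℝ) (π : S → A) (γ R : ℝ)
    (hγ0 : 0 ≤ γ) (hγ1 : γ < 1) (hR : ∀ s a, |r s a| ≤ R)
    (B : Set S) (c : S → S) (ε : S → ℝ) (hε0 : ∀ b ∈ B, 0 ≤ ε b)
    (hstitch : ∀ b ∈ B, |V T r π γ (T b (π b)) - V T r π γ (c b)| ≤ ε b)
    (hSum : ∀ s, Summable (fun k : ℕ =>
      γ ^ k * rPess r π B ε γ (traj (Tstitch T π B c) π s k)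
        (π (traj (Tstitch T π B c) π s k)))) :
    ∀ s, V (Tstitch T π B c) (rPess r π B ε γ) π γ s ≤ V T r π γ s := by
  intro s
  set W := V T r π γ with hW
  set x := traj (Tstitch T π B c) π s with hx
  have step : ∀ y, rPess r π B ε γ y (π y) + γ * W (Tstitch T π B c y (π y)) ≤ W y := by
    intro y
    have hb := V_bellman T r π γ R hγ0 hγ1 hR y
    rw [← hW] at hb
    by_cases hy : y ∈ B
    · have h1 := (abs_le.mp (hstitch y hy)).1
      have h2 := mul_le_mul_of_nonneg_left h1 hγ0
      simp only [rPess, Tstitch, hy, and_self, if_true]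
      rw [hb]
      nlinarith
    · simp only [rPess, Tstitch, hy, false_and, if_false]
      exact hb.ge
  have hxs : ∀ n, x (n + 1) = Tstitch T π B c (x n) (π (x n)) := by
    intro n
    simp only [hx, traj, Function.iterate_succ_apply']
  have key : ∀ n, ∑ k ∈ Finset.range n, γ ^ k * rPess r π B ε γ (x k) (π (x k))
      + γ ^ n * W (x n) ≤ W s := by
    intro n
    induction n with
    | zero => simp [hx, traj]
    | succ n ih =>
      rw [Finset.sum_range_succ, hxs]
      have h := mul_le_mul_of_nonneg_left (step (x n)) (pow_nonneg hγ0 n)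
      rw [pow_succ]
      nlinarith
  have lim0 : Filter.Tendsto (fun n => γ ^ n * W (x n)) Filter.atTop (nhds 0) := by
    have hg : Filter.Tendsto (fun n : ℕ => γ ^ n * ((1 - γ)⁻¹ * R)) Filter.atTop (nhds 0) := by
      simpa using (tendsto_pow_atTop_nhds_zero_of_lt_one hγ0 hγ1).mul_const ((1 - γ)⁻¹ * R)
    refine squeeze_zero_norm (fun n => ?_) hg
    rw [Real.norm_eq_abs, abs_mul, abs_of_nonneg (pow_nonneg hγ0 n)]
    exact mul_le_mul_of_nonneg_left (V_abs_le T r π γ R hγ0 hγ1 hR _) (pow_nonneg hγ0 n)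
  have lim1 := ((hSum s).hasSum.tendsto_sum_nat).add lim0
  rw [add_zero] at lim1
  exact le_of_tendsto' lim1 key
end

section
/- (The on-policy bisimulation operator is a contraction.) Consider the space of bounded functions d : S × S → ℝ equipped with the supremum metric, and the operator F defined by (F d)(s, t) = |r(s, π(s)) − r(t, π(t))| + γ · d(T(s, π(s)), T(t, π(t))). Then F maps bounded functions to bounded functions and is Lipschitz with constant γ < 1 with respect to the supremum metric; consequently F has a unique bounded fixed point d^π. -/
/-- The deterministic on-policy bisimulation operator
`(F d)(s,t) = |r(s,π(s)) − r(t,π(t))| + γ * d(T(s,π(s)), T(t,π(t)))`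
maps bounded functions to bounded functions, is Lipschitz with constant `γ < 1` with respect
to the supremum metric, and consequently has a unique bounded fixed point. -/
theorem bisim_operator_contraction {S A : Type*} [Nonempty S]
    (T : S → A → S) (r : S → A → ℝ) (π : S → A) (γ R : ℝ)
    (hγ0 : 0 ≤ γ) (hγ1 : γ < 1) (hR : ∀ s a, |r s a| ≤ R)
    (F : (S × S → ℝ) → (S × S → ℝ))
    (hF : ∀ d p, F d p =
      |r p.1 (π p.1) - r p.2 (π p.2)| + γ * d (T p.1 (π p.1), T p.2 (π p.2))) :
    (∀ d : S × S → ℝ, (∃ C, ∀ p, |d p| ≤ C) → ∃ C, ∀ p, |F d p| ≤ C) ∧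
    (∀ d₁ d₂ : S × S → ℝ, ∀ K : ℝ, (∀ p, |d₁ p - d₂ p| ≤ K) →
      ∀ p, |F d₁ p - F d₂ p| ≤ γ * K) ∧
    (∃! d : S × S → ℝ, (∃ C, ∀ p, |d p| ≤ C) ∧ F d = d) := by
  have hc : ∀ p : S × S, |r p.1 (π p.1) - r p.2 (π p.2)| ≤ 2 * R := by
    intro p
    have h1 := abs_le.1 (hR p.1 (π p.1))
    have h2 := abs_le.1 (hR p.2 (π p.2))
    rw [abs_le]
    constructor <;> linarith
  have hLip : ∀ d₁ d₂ : S × S → ℝ, ∀ K : ℝ, (∀ p, |d₁ p - d₂ p| ≤ K) →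
      ∀ p, |F d₁ p - F d₂ p| ≤ γ * K := by
    intro d₁ d₂ K hK p
    rw [hF, hF, add_sub_add_left_eq_sub, ← mul_sub, abs_mul, abs_of_nonneg hγ0]
    exact mul_le_mul_of_nonneg_left (hK _) hγ0
  refine ⟨?_, hLip, ?_⟩
  · rintro d ⟨C, hC⟩
    refine ⟨2 * R + γ * C, fun p => ?_⟩
    rw [hF]
    refine (abs_add_le _ _).trans (add_le_add ?_ ?_)
    · rw [abs_abs]
      exact hc p
    · rw [abs_mul, abs_of_nonneg hγ0]
      exact mul_le_mul_of_nonneg_left (hC _) hγ0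
  · -- the fixed point is the discounted sum of reward gaps along the paired trajectory
    let g : S × S → S × S := fun p => (T p.1 (π p.1), T p.2 (π p.2))
    let c : S × S → ℝ := fun p => |r p.1 (π p.1) - r p.2 (π p.2)|
    have hb : ∀ p (n : ℕ), ‖γ ^ n * c (g^[n] p)‖ ≤ γ ^ n * (2 * R) := by
      intro p n
      rw [Real.norm_eq_abs, abs_mul, abs_of_nonneg (pow_nonneg hγ0 n)]
      refine mul_le_mul_of_nonneg_left ?_ (pow_nonneg hγ0 n)
      simp only [c, abs_abs]
      exact hc _
    have hgeo := (hasSum_geometric_of_lt_one hγ0 hγ1).mul_right (2 * R)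
    have hs : ∀ p, Summable (fun n : ℕ => γ ^ n * c (g^[n] p)) := fun p =>
      Summable.of_norm_bounded hgeo.summable (hb p)
    refine ⟨fun p => ∑' n : ℕ, γ ^ n * c (g^[n] p), ⟨⟨(1 - γ)⁻¹ * (2 * R), fun p => ?_⟩, ?_⟩, ?_⟩
    · exact tsum_of_norm_bounded hgeo (hb p)
    · funext p
      rw [hF]
      rw [(hs p).tsum_eq_zero_add, ← tsum_mul_left]
      simp only [pow_zero, one_mul, Function.iterate_zero, id, Function.iterate_succ_apply,
        pow_succ']
      simp only [c, g, mul_assoc]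
    · rintro d ⟨⟨C, hC⟩, hd⟩
      generalize he : (fun p => ∑' n : ℕ, γ ^ n * c (g^[n] p)) = e
      have heC : ∀ p, |e p| ≤ (1 - γ)⁻¹ * (2 * R) := by
        intro p
        rw [← he]
        exact tsum_of_norm_bounded hgeo (hb p)
      have hef : F e = e := by
        funext p
        rw [hF, ← he]
        dsimp only
        rw [(hs p).tsum_eq_zero_add, ← tsum_mul_left]
        simp only [pow_zero, one_mul, Function.iterate_zero, id, Function.iterate_succ_apply,
          pow_succ']
        simp only [c, g, mul_assoc]
      have hn : ∀ n : ℕ, ∀ p, |d p - e p| ≤ γ ^ n * (C + (1 - γ)⁻¹ * (2 * R)) := by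
        intro n
        induction n with
        | zero =>
          intro p
          rw [pow_zero, one_mul]
          exact (abs_sub _ _).trans (add_le_add (hC p) (heC p))
        | succ n ih =>
          intro p
          have h := hLip d e _ ih p
          rw [hd, hef] at h
          rw [pow_succ', mul_assoc]
          exact h
      funext p
      have ht := (tendsto_pow_atTop_nhds_zero_of_lt_one hγ0 hγ1).mul_const
        (C + (1 - γ)⁻¹ * (2 * R))
      rw [zero_mul] at ht
      have h0 : |d p - e p| ≤ 0 := ge_of_tendsto' ht (fun n => hn n p)
      exact sub_eq_zero.1 (abs_nonpos_iff.1 h0)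
end

section
/- (Theorem 3 of Castro 2019, deterministic form, for the fixed-point metric.) Let d^π(s, t) = ∑_{k=0}^∞ γ^k · |r(s_k, π(s_k)) − r(t_k, π(t_k))|, where (s_k) and (t_k) are the trajectories of π from s and t. Then for any two states s, t: |V^π(s) − V^π(t)| ≤ d^π(s, t). -/
/-- Theorem 3 of Castro 2019, deterministic form, for the fixed-point metric
`d^π(s,t) = ∑_{k=0}^∞ γ^k |r(s_k,π(s_k)) − r(t_k,π(t_k))|`:
`|V^π(s) − V^π(t)| ≤ d^π(s,t)`. -/
theorem value_diff_le_bisim_metric {S A : Type*}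
    (T : S → A → S) (r : S → A → ℝ) (π : S → A) (γ R : ℝ)
    (hγ0 : 0 ≤ γ) (hγ1 : γ < 1) (hR : ∀ s a, |r s a| ≤ R) (s t : S) :
    |V T r π γ s - V T r π γ t| ≤
      ∑' k : ℕ,
        γ ^ k * |r (traj T π s k) (π (traj T π s k)) - r (traj T π t k) (π (traj T π t k))| := by
  have hsum : ∀ u : S, Summable fun k : ℕ =>
      γ ^ k * r (traj T π u k) (π (traj T π u k)) := by
    intro u
    refine Summable.of_norm_bounded
      ((summable_geometric_of_lt_one hγ0 hγ1).mul_right R) (fun k => ?_)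
    rw [Real.norm_eq_abs, abs_mul, abs_of_nonneg (pow_nonneg hγ0 k)]
    exact mul_le_mul_of_nonneg_left (hR _ _) (pow_nonneg hγ0 k)
  have hterm : ∀ k : ℕ,
      γ ^ k * |r (traj T π s k) (π (traj T π s k)) - r (traj T π t k) (π (traj T π t k))| =
      ‖γ ^ k * r (traj T π s k) (π (traj T π s k)) -
        γ ^ k * r (traj T π t k) (π (traj T π t k))‖ := by
    intro k
    rw [← mul_sub, Real.norm_eq_abs, abs_mul, abs_of_nonneg (pow_nonneg hγ0 k)]
  unfold V
  rw [← (hsum s).tsum_sub (hsum t), tsum_congr hterm, ← Real.norm_eq_abs]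
  exact norm_tsum_le_tsum_norm ((hsum s).sub (hsum t)).norm
end
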